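/- arXiv:1710.10465 — 2 statements merged into one kernel-verified Lean document; each statement's English description precedes it below -/
import Mathlib

section
/- Let K be a field and R the subalgebra of K^ω of eventually constant sequences, with idempotents e_i and S = R/Soc(R). Then for every R-module M there exist cardinals κ, λ and κ_i (i < ω), uniquely determined by M, and an R-module N, such that M ≅ S^(κ) ⊕ N (direct sum of κ copies of S with N), Soc(N) ≅ ⊕_{i<ω} (e_iR)^(κ_i), and N/Soc(N) ≅ S^(λ). -/
/-- The unital `K`-subalgebra of `K^ω` consisting of all eventually constant sequences. -/
def evConst (K : Type*) [Field K] : Subalgebra K (ℕ → K) where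
  carrier := {x | ∃ (N : ℕ) (c : K), ∀ n, N ≤ n → x n = c}
  add_mem' := by
    rintro x y ⟨N, c, hN⟩ ⟨M, d, hM⟩
    exact ⟨max N M, c + d, fun n hn => by
      simp [Pi.add_apply, hN n (le_trans (le_max_left N M) hn),
        hM n (le_trans (le_max_right N M) hn)]⟩
  mul_mem' := by
    rintro x y ⟨N, c, hN⟩ ⟨M, d, hM⟩
    exact ⟨max N M, c * d, fun n hn => by
      simp [Pi.mul_apply, hN n (le_trans (le_max_left N M) hn),
        hM n (le_trans (le_max_right N M) hn)]⟩
  algebraMap_mem' := fun a => ⟨0, a, fun n _ => rfl⟩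

/-- The ring of eventually constant sequences in `K^ω`, as a type. -/
def EvRing (K : Type*) [Field K] : Type _ := evConst K

instance (K : Type*) [Field K] : CommRing (EvRing K) :=
  inferInstanceAs (CommRing (evConst K))

instance (K : Type*) [Field K] : Algebra K (EvRing K) :=
  inferInstanceAs (Algebra K (evConst K))

/-- The underlying sequence of an element of `EvRing K`. -/
def EvRing.seq {K : Type*} [Field K] (x : EvRing K) : ℕ → K :=
  Subtype.val (p := fun x => x ∈ evConst K) x

/-- The idempotent `e i ∈ EvRing K` whose `i`-th component is `1` and all
other components are `0`. -/
def evIdem (K : Type*) [Field K] (i : ℕ) : EvRing K :=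
  (⟨fun n => if n = i then 1 else 0, ⟨i + 1, 0, fun n hn => if_neg (by omega)⟩⟩ :
    evConst K)

/-- The socle of a module: the sum of all its simple submodules. -/
def moduleSocle (R : Type*) [Ring R] (M : Type*) [AddCommGroup M] [Module R M] :
    Submodule R M :=
  sSup {p : Submodule R M | IsSimpleModule R p}

theorem EvH.seq_ext {K : Type*} [Field K] {x y : EvRing K} (h : ∀ n, x.seq n = y.seq n) : x = y :=
  Subtype.ext (funext h)

namespace EvH

theorem exists_lim {K : Type*} [Field K] (r : EvRing K) : ∃ c : K, ∃ N : ℕ, ∀ n, N ≤ n → r.seq n = c := by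
  obtain ⟨x, N, c, h⟩ := r
  exact ⟨c, N, h⟩

noncomputable def lim {K : Type*} [Field K] (r : EvRing K) : K := (exists_lim r).choose

theorem seq_mul {K : Type*} [Field K] (x y : EvRing K) (n : ℕ) : (x * y).seq n = x.seq n * y.seq n := rfl
theorem seq_add {K : Type*} [Field K] (x y : EvRing K) (n : ℕ) : (x + y).seq n = x.seq n + y.seq n := rfl
theorem seq_one {K : Type*} [Field K] (n : ℕ) : (1 : EvRing K).seq n = 1 := rfl
theorem seq_zero {K : Type*} [Field K] (n : ℕ) : (0 : EvRing K).seq n = 0 := rfl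
theorem seq_smul {K : Type*} [Field K] (c : K) (y : EvRing K) (n : ℕ) : (c • y).seq n = c * y.seq n := rfl
theorem seq_idem {K : Type*} [Field K] (i n : ℕ) : (evIdem K i).seq n = if n = i then 1 else 0 := rfl
theorem seq_sum {K : Type*} [Field K] (s : Finset ℕ) (f : ℕ → EvRing K) (n : ℕ) :
    (∑ i ∈ s, f i).seq n = ∑ i ∈ s, (f i).seq n := by
  classical
  induction s using Finset.induction_on with
  | empty => rfl
  | insert a s ha ih => rw [Finset.sum_insert ha, Finset.sum_insert ha, seq_add, ih]

theorem lim_spec {K : Type*} [Field K] (r : EvRing K) :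
    ∃ N : ℕ, r = lim r • (1 : EvRing K) + ∑ i ∈ Finset.range N, (r.seq i - lim r) • evIdem K i := by
  obtain ⟨N, hN⟩ := (exists_lim r).choose_spec
  refine ⟨N, seq_ext fun n => ?_⟩
  rw [seq_add, seq_sum, seq_smul, seq_one]
  simp only [seq_smul, seq_idem, mul_ite, mul_one, mul_zero, Finset.sum_ite_eq, Finset.mem_range]
  split_ifs with h
  · ring
  · rw [add_zero]; exact hN n (not_lt.mp h)

theorem mul_idem {K : Type*} [Field K] (r : EvRing K) (i : ℕ) : r * evIdem K i = r.seq i • evIdem K i := by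
  refine seq_ext fun n => ?_
  rw [seq_mul, seq_smul, seq_idem]
  split_ifs with h
  · rw [h]
  · simp

theorem idem_mul_idem {K : Type*} [Field K] (i j : ℕ) :
    evIdem K i * evIdem K j = if i = j then evIdem K i else 0 := by
  refine seq_ext fun n => ?_
  rw [mul_idem, seq_smul, seq_idem, seq_idem]
  split_ifs <;> simp_all [seq_idem, seq_zero]

theorem idem_ne_zero {K : Type*} [Field K] (i : ℕ) : evIdem K i ≠ 0 := fun h => by
  have := congrArg (fun x => EvRing.seq x i) h
  simp [seq_idem, seq_zero] at this

section
variable (K : Type*) [Field K] (M : Type*) [AddCommGroup M] [Module (EvRing K) M]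

/-- elements killed by all `e_i` -/
def A : Submodule (EvRing K) M where
  carrier := {m | ∀ i, evIdem K i • m = 0}
  add_mem' := fun ha hb i => by rw [smul_add, ha i, hb i, add_zero]
  zero_mem' := fun i => smul_zero _
  smul_mem' := fun r m hm i => by rw [smul_comm, hm i, smul_zero]

/-- elements fixed by `e_i` -/
def E (i : ℕ) : Submodule (EvRing K) M where
  carrier := {m | evIdem K i • m = m}
  add_mem' := fun {a b} ha hb => by
    show evIdem K i • (a + b) = a + b
    rw [smul_add, ha, hb]
  zero_mem' := smul_zero _
  smul_mem' := fun r m hm => by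
    show evIdem K i • (r • m) = r • m
    rw [smul_comm, hm]

def U : Submodule (EvRing K) M := ⨆ i, E K M i

variable {K M}

theorem mem_A {m : M} : m ∈ A K M ↔ ∀ i, evIdem K i • m = 0 := Iff.rfl
theorem mem_E {i : ℕ} {m : M} : m ∈ E K M i ↔ evIdem K i • m = m := Iff.rfl

theorem idem_smul_mem (i : ℕ) (m : M) : evIdem K i • m ∈ E K M i := by
  rw [mem_E, smul_smul, idem_mul_idem, if_pos rfl]

theorem E_le_U (i : ℕ) : E K M i ≤ U K M := le_iSup (E K M) i

theorem smul_E_ne {i j : ℕ} (h : i ≠ j) {m : M} (hm : m ∈ E K M j) : evIdem K i • m = 0 := by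
  rw [← mem_E.mp hm, smul_smul, idem_mul_idem, if_neg h, zero_smul]

theorem U_fixed {m : M} (hm : m ∈ U K M) :
    ∃ n, ∀ k, n ≤ k → (∑ i ∈ Finset.range k, evIdem K i) • m = m := by
  refine Submodule.iSup_induction (E K M) (motive := fun m => ∃ n, ∀ k, n ≤ k →
    (∑ i ∈ Finset.range k, evIdem K i) • m = m) hm ?_ ?_ ?_
  · intro i x hx
    refine ⟨i + 1, fun k hk => ?_⟩
    rw [Finset.sum_smul, Finset.sum_eq_single i]
    · exact hx
    · intro b _ hb
      exact smul_E_ne hb hx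
    · intro h
      exact absurd (Finset.mem_range.mpr (by omega)) h
  · exact ⟨0, fun _ _ => smul_zero _⟩
  · rintro x y ⟨n, hn⟩ ⟨m, hm⟩
    refine ⟨max n m, fun k hk => ?_⟩
    rw [smul_add, hn k (le_trans (le_max_left _ _) hk), hm k (le_trans (le_max_right _ _) hk)]

theorem A_inf_U {m : M} (h1 : m ∈ A K M) (h2 : m ∈ U K M) : m = 0 := by
  obtain ⟨n, hn⟩ := U_fixed h2
  rw [← hn n le_rfl, Finset.sum_smul]
  exact Finset.sum_eq_zero fun i _ => h1 i

theorem E_indep : iSupIndep (E K M) := by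
  intro i
  rw [Submodule.disjoint_def]
  intro x hx hx'
  have : (⨆ j, ⨆ (_ : j ≠ i), E K M j) ≤ LinearMap.ker (LinearMap.lsmul (EvRing K) M (evIdem K i)) := by
    refine iSup_le fun j => iSup_le fun hj => fun y hy => ?_
    rw [LinearMap.mem_ker, LinearMap.lsmul_apply]
    exact smul_E_ne hj.symm hy
  have h := this hx'
  rw [LinearMap.mem_ker, LinearMap.lsmul_apply, mem_E.mp hx] at h
  exact h

theorem A_smul [Module K M] [IsScalarTower K (EvRing K) M] {m : M} (hm : m ∈ A K M) (r : EvRing K) :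
    r • m = lim r • m := by
  obtain ⟨N, hN⟩ := lim_spec r
  conv_lhs => rw [hN]
  rw [add_smul, smul_assoc, one_smul, Finset.sum_smul, Finset.sum_eq_zero, add_zero]
  intro i _
  rw [smul_assoc, hm i, smul_zero]

theorem E_smul [Module K M] [IsScalarTower K (EvRing K) M] {i : ℕ} {m : M} (hm : m ∈ E K M i) (r : EvRing K) :
    r • m = r.seq i • m := by
  conv_lhs => rw [← mem_E.mp hm, smul_smul, mul_idem, smul_assoc, mem_E.mp hm]

theorem simple_span [Module K M] [IsScalarTower K (EvRing K) M] (φ : EvRing K → K) {m : M}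
    (h : ∀ r : EvRing K, r • m = φ r • m) (hm : m ≠ 0) :
    IsSimpleModule (EvRing K) (Submodule.span (EvRing K) {m}) := by
  rw [isSimpleModule_iff_isAtom]
  refine ⟨by simpa using hm, fun b hb => ?_⟩
  by_contra hne
  obtain ⟨x, hx, hx0⟩ := (Submodule.ne_bot_iff _).mp hne
  obtain ⟨r, rfl⟩ := Submodule.mem_span_singleton.mp (hb.le hx)
  refine hb.not_ge ?_
  rw [Submodule.span_singleton_le_iff_mem]
  have hr : φ r ≠ 0 := by
    intro h0
    rw [h, h0, zero_smul] at hx0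
    exact hx0 rfl
  have : ((φ r)⁻¹ • (1 : EvRing K)) • (r • m) = m := by
    rw [smul_assoc, one_smul, h r, smul_smul, inv_mul_cancel₀ hr, one_smul]
  rw [← this]
  exact b.smul_mem _ hx

theorem mem_socle [Module K M] [IsScalarTower K (EvRing K) M] (φ : EvRing K → K) {m : M}
    (h : ∀ r : EvRing K, r • m = φ r • m) : m ∈ moduleSocle (EvRing K) M := by
  by_cases hm : m = 0
  · rw [hm]; exact zero_mem _
  · exact (le_sSup (simple_span φ h hm) : Submodule.span (EvRing K) {m} ≤ _)
      (Submodule.mem_span_singleton_self m)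

theorem E_le_socle [Module K M] [IsScalarTower K (EvRing K) M] (i : ℕ) :
    E K M i ≤ moduleSocle (EvRing K) M :=
  fun _ hm => mem_socle (fun r => r.seq i) (E_smul hm)

theorem A_le_socle [Module K M] [IsScalarTower K (EvRing K) M] :
    A K M ≤ moduleSocle (EvRing K) M :=
  fun _ hm => mem_socle lim (A_smul hm)

theorem socle_eq [Module K M] [IsScalarTower K (EvRing K) M] (hA : A K M = ⊥) :
    moduleSocle (EvRing K) M = U K M := by
  refine le_antisymm (sSup_le fun p hp => ?_) (iSup_le E_le_socle)
  have hp : IsSimpleModule (EvRing K) p := hp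
  rw [isSimpleModule_iff_isAtom] at hp
  obtain ⟨x, hx, hx0⟩ := (Submodule.ne_bot_iff _).mp hp.1
  have hxA : x ∉ A K M := by rw [hA]; simpa using hx0
  rw [mem_A] at hxA
  push Not at hxA
  obtain ⟨i, hi⟩ := hxA
  have hle : p ⊓ E K M i = p := by
    rcases hp.le_iff.mp (inf_le_left : p ⊓ E K M i ≤ p) with h | h
    · have h2 : evIdem K i • x ∈ p ⊓ E K M i := ⟨p.smul_mem _ hx, idem_smul_mem i x⟩
      rw [h, Submodule.mem_bot] at h2
      exact absurd h2 hi
    · exact h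
  exact (inf_eq_left.mp hle).trans (E_le_U i)

theorem exists_compl [Module K M] [IsScalarTower K (EvRing K) M] :
    ∃ N : Submodule (EvRing K) M, IsCompl (A K M) N := by
  have hss : IsSemisimpleModule (EvRing K) (M ⧸ U K M) := by
    rw [← sSup_simples_eq_top_iff_isSemisimpleModule]
    rw [eq_top_iff]
    rintro x -
    refine mem_socle (K := K) lim (A_smul ?_)
    intro i
    obtain ⟨m, rfl⟩ := Submodule.mkQ_surjective _ x
    rw [← map_smul, Submodule.mkQ_apply, Submodule.Quotient.mk_eq_zero]
    exact E_le_U i (idem_smul_mem i m)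
  obtain ⟨Q, hQ⟩ := exists_isCompl ((A K M).map (U K M).mkQ)
  refine ⟨Q.comap (U K M).mkQ, ?_, ?_⟩
  · rw [Submodule.disjoint_def]
    intro x hx hx'
    have := (Submodule.disjoint_def.mp hQ.1) _ (Submodule.mem_map_of_mem hx) hx'
    rw [Submodule.mkQ_apply, Submodule.Quotient.mk_eq_zero] at this
    exact A_inf_U hx this
  · rw [codisjoint_iff, eq_top_iff]
    rintro x -
    have : (U K M).mkQ x ∈ (A K M).map (U K M).mkQ ⊔ Q := by rw [hQ.sup_eq_top]; trivial
    obtain ⟨y, ⟨a, ha, rfl⟩, q, hq, h⟩ := Submodule.mem_sup.mp this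
    refine Submodule.mem_sup.mpr ⟨a, ha, x - a, ?_, by abel⟩
    rw [Submodule.mem_comap, map_sub, ← h]
    simpa using hq

end

abbrev S (K : Type*) [Field K] := EvRing K ⧸ (moduleSocle (EvRing K) (EvRing K) : Ideal (EvRing K))

theorem A_S (K : Type*) [Field K] (v : S K) (i : ℕ) : evIdem K i • v = 0 := by
  obtain ⟨r, rfl⟩ := Ideal.Quotient.mk_surjective v
  refine (Submodule.Quotient.mk_eq_zero (moduleSocle (EvRing K) (EvRing K)) (x := evIdem K i • r)).mpr ?_
  exact E_le_socle (K := K) i (idem_smul_mem i r)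

theorem A_EvRing (K : Type*) [Field K] : A K (EvRing K) = ⊥ := by
  rw [eq_bot_iff]
  intro r hr
  rw [Submodule.mem_bot]
  refine seq_ext fun n => ?_
  have := congrArg (fun x => EvRing.seq x n) (hr n)
  simpa [seq_mul, seq_idem, seq_zero] using this

theorem rank_S (K : Type*) [Field K] : Module.rank K (S K) = 1 := by
  rw [rank_eq_one_iff]
  refine ⟨Ideal.Quotient.mk _ 1, ?_, fun v => ?_⟩
  · rw [Ne, Ideal.Quotient.eq_zero_iff_mem, socle_eq (A_EvRing K)]
    intro h
    obtain ⟨n, hn⟩ := U_fixed h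
    have := congrArg (fun x => EvRing.seq x n) (hn n le_rfl)
    simp [seq_sum, seq_idem, seq_one] at this
  · obtain ⟨r, rfl⟩ := Ideal.Quotient.mk_surjective v
    refine ⟨lim r, ?_⟩
    rw [← A_smul (A_S K _)]
    show Ideal.Quotient.mk _ (r * 1) = _
    rw [mul_one]

theorem E_span (K : Type*) [Field K] (i : ℕ) (v : (Ideal.span {evIdem K i} : Ideal (EvRing K))) :
    evIdem K i • v = v := by
  obtain ⟨v, hv⟩ := v
  obtain ⟨r, rfl⟩ := Ideal.mem_span_singleton'.mp hv
  refine Subtype.ext ?_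
  show evIdem K i * (r * evIdem K i) = r * evIdem K i
  rw [mul_left_comm, idem_mul_idem, if_pos rfl]

theorem rank_span (K : Type*) [Field K] (i : ℕ) :
    Module.rank K (Ideal.span {evIdem K i} : Ideal (EvRing K)) = 1 := by
  rw [rank_eq_one_iff]
  refine ⟨⟨evIdem K i, Ideal.mem_span_singleton_self _⟩, ?_, fun v => ?_⟩
  · intro h
    exact idem_ne_zero i (congrArg Subtype.val h)
  · obtain ⟨v, hv⟩ := v
    obtain ⟨r, rfl⟩ := Ideal.mem_span_singleton'.mp hv
    refine ⟨r.seq i, Subtype.ext ?_⟩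
    exact (mul_idem r i).symm

universe u v w

theorem equiv_upgrade {K : Type u} [Field K] {V : Type v} {W : Type w} [AddCommGroup V] [AddCommGroup W]
    [Module (EvRing K) V] [Module (EvRing K) W] [Module K V] [Module K W]
    [IsScalarTower K (EvRing K) V] [IsScalarTower K (EvRing K) W]
    (φ : EvRing K → K) (hV : ∀ (r : EvRing K) (x : V), r • x = φ r • x)
    (hW : ∀ (r : EvRing K) (x : W), r • x = φ r • x) :
    Nonempty (V ≃ₗ[EvRing K] W) ↔
      Cardinal.lift.{w} (Module.rank K V) = Cardinal.lift.{v} (Module.rank K W) := by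
  rw [← Module.nonempty_linearEquiv_iff_lift_rank_eq]
  constructor
  · rintro ⟨e⟩
    exact ⟨e.restrictScalars K⟩
  · rintro ⟨e⟩
    exact ⟨{ e with map_smul' := fun r x => (by
              rw [hV, hW, map_smul] : e (r • x) = r • e x) }⟩

theorem rank_finsupp_one {K : Type u} [Field K] {V : Type u} [AddCommGroup V] [Module K V]
    (h : Module.rank K V = 1) (ι : Type w) :
    Module.rank K (ι →₀ V) = Cardinal.lift.{u} (Cardinal.mk ι) := by
  rw [rank_finsupp, h]; simp

theorem card_aux (a : Cardinal.{v}) (c : Cardinal.{max u v}) :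
    Cardinal.lift.{max u v, v} a = Cardinal.lift.{v, max u v} (Cardinal.lift.{u, max u v} c) ↔
      c = Cardinal.lift.{u, v} a := by
  have h1 : Cardinal.lift.{max u v, v} a = Cardinal.lift.{u, v} a := by
    rw [Cardinal.lift_umax.{v, u}]
  have h2 : Cardinal.lift.{v, max u v} (Cardinal.lift.{u, max u v} c) = c := by
    rw [Cardinal.lift_lift]; exact Cardinal.lift_id' c
  rw [h1, h2]
  exact eq_comm

theorem equiv_S {K : Type u} [Field K] {V : Type v} [AddCommGroup V]
    [Module (EvRing K) V] [Module K V] [IsScalarTower K (EvRing K) V]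
    (hV : ∀ (x : V) i, evIdem K i • x = 0) (c : Cardinal.{max u v}) :
    Nonempty (V ≃ₗ[EvRing K] (Quotient.out c →₀ S K)) ↔ c = Cardinal.lift.{u} (Module.rank K V) := by
  rw [equiv_upgrade lim (fun r x => A_smul (hV x) r)
    (fun r x => A_smul (fun i => by ext j; exact A_S K (x j) i) r)]
  rw [rank_finsupp_one (rank_S K), Cardinal.mk_out]
  exact card_aux _ _

theorem equiv_E {K : Type u} [Field K] {V : Type v} [AddCommGroup V]
    [Module (EvRing K) V] [Module K V] [IsScalarTower K (EvRing K) V] (i : ℕ)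
    (hV : ∀ (x : V), evIdem K i • x = x) (c : Cardinal.{max u v}) :
    Nonempty (V ≃ₗ[EvRing K] (Quotient.out c →₀ (Ideal.span {evIdem K i} : Ideal (EvRing K)))) ↔
      c = Cardinal.lift.{u} (Module.rank K V) := by
  rw [equiv_upgrade (fun r => r.seq i) (fun r x => E_smul (hV x) r)
    (fun r x => E_smul (by rw [mem_E]; ext j; exact congrArg Subtype.val (E_span K i (x j))) r)]
  rw [rank_finsupp_one (rank_span K i), Cardinal.mk_out]
  exact card_aux _ _


open DirectSum in
/-- the property in the theorem -/
def P (K : Type u) [Field K] (M : Type v) [AddCommGroup M] [Module (EvRing K) M]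
    (c : Cardinal.{max u v} × Cardinal.{max u v} × (ℕ → Cardinal.{max u v})) : Prop :=
      ∃ (N : Type (max u v)) (_ : AddCommGroup N) (_ : Module (EvRing K) N),
        Nonempty (M ≃ₗ[EvRing K]
          ((Quotient.out c.1 →₀
              (EvRing K ⧸ (moduleSocle (EvRing K) (EvRing K) : Ideal (EvRing K)))) × N)) ∧
        Nonempty ((moduleSocle (EvRing K) N) ≃ₗ[EvRing K]
          ⨁ i : ℕ, (Quotient.out (c.2.2 i) →₀ (Ideal.span {evIdem K i} : Ideal (EvRing K)))) ∧
        Nonempty ((N ⧸ moduleSocle (EvRing K) N) ≃ₗ[EvRing K]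
          (Quotient.out c.2.1 →₀
            (EvRing K ⧸ (moduleSocle (EvRing K) (EvRing K) : Ideal (EvRing K)))))

theorem P_exists (K : Type u) [Field K] (M : Type v) [AddCommGroup M] [Module (EvRing K) M]
    [Module K M] [IsScalarTower K (EvRing K) M] : ∃ c, P.{u, v} K M c := by
  obtain ⟨N0, hN⟩ := exists_compl (K := K) (M := M)
  let N := ULift.{u} N0
  have hAN : A K N = ⊥ := by
    rw [eq_bot_iff]
    intro x hx
    rw [Submodule.mem_bot]
    have h0 : (x.down : M) = 0 := by
      refine (Submodule.disjoint_def.mp hN.1) _ (fun i => ?_) x.down.2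
      have := congrArg (fun y : N => (y.down : M)) (hx i)
      exact this
    exact ULift.ext _ _ (Subtype.ext h0)
  have hsoc := socle_eq hAN
  refine ⟨(Cardinal.lift.{u} (Module.rank K (A K M)),
    Module.rank K (N ⧸ moduleSocle (EvRing K) N), fun i => Module.rank K (E K N i)), N,
    inferInstance, inferInstance, ?_, ?_, ?_⟩
  · obtain ⟨e⟩ := (equiv_S (K := K) (V := A K M) (fun x i => Subtype.ext (x.2 i)) _).mpr rfl
    exact ⟨(Submodule.prodEquivOfIsCompl _ _ hN).symm ≪≫ₗ
      (e.prodCongr ULift.moduleEquiv.symm)⟩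
  · have he : ∀ i, Nonempty (E K N i ≃ₗ[EvRing K]
        (Quotient.out (Module.rank K (E K N i)) →₀ (Ideal.span {evIdem K i} : Ideal (EvRing K)))) :=
      fun i => (equiv_E.{u, max u v} (K := K) (V := E K N i) i (fun x => Subtype.ext (mem_E.mp x.2)) _).mpr
        (Cardinal.lift_id' _).symm
    have e := fun i => (he i).some
    exact ⟨LinearEquiv.ofEq _ _ (hsoc.trans (Submodule.iSup_eq_range_dfinsupp_lsum _)) ≪≫ₗ
      (LinearEquiv.ofInjective _ (E_indep (K := K) (M := N)).dfinsupp_lsum_injective).symm ≪≫ₗ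
      DFinsupp.mapRange.linearEquiv e⟩
  · refine (equiv_S.{u, max u v} (K := K) ?_ _).mpr (Cardinal.lift_id' _).symm
    intro x i
    obtain ⟨m, rfl⟩ := Submodule.mkQ_surjective _ x
    rw [← map_smul, Submodule.mkQ_apply, Submodule.Quotient.mk_eq_zero]
    exact E_le_socle (K := K) i (idem_smul_mem i m)

theorem U_map {K : Type*} [Field K] {M N : Type*} [AddCommGroup M] [AddCommGroup N]
    [Module (EvRing K) M] [Module (EvRing K) N] (f : M →ₗ[EvRing K] N) {m : M} (hm : m ∈ U K M) :
    f m ∈ U K N := by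
  have : U K M ≤ (U K N).comap f := by
    refine iSup_le fun i x hx => E_le_U i ?_
    rw [mem_E, ← map_smul, mem_E.mp hx]
  exact this hm

theorem P_unique (K : Type u) [Field K] (M : Type v) [AddCommGroup M] [Module (EvRing K) M]
    [Module K M] [IsScalarTower K (EvRing K) M]
    (c : Cardinal.{max u v} × Cardinal.{max u v} × (ℕ → Cardinal.{max u v}))
    (hc : P.{u, v} K M c) :
    c = (Cardinal.lift.{u} (Module.rank K (A K M)),
      Cardinal.lift.{u} (Module.rank K (M ⧸ (A K M ⊔ U K M))),
      fun i => Cardinal.lift.{u} (Module.rank K (E K M i))) := by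
  obtain ⟨k, l, ks⟩ := c
  obtain ⟨N, _, _, ⟨φ⟩, ⟨ψ⟩, ⟨χ⟩⟩ := hc
  dsimp only at φ ψ χ
  let _ : Module K N := Module.compHom N (algebraMap K (EvRing K))
  have _ : IsScalarTower K (EvRing K) N := ⟨fun a b x => by
    show (a • b) • x = (algebraMap K (EvRing K) a) • (b • x)
    rw [smul_smul, Algebra.smul_def]⟩
  have hF : ∀ (f : Quotient.out k →₀ S K) i, evIdem K i • f = 0 := fun f i => by
    ext j; exact A_S K (f j) i
  have hAN : A K N = ⊥ := by
    rw [eq_bot_iff]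
    intro x hx
    have hs : x ∈ moduleSocle (EvRing K) N := A_le_socle hx
    have h0 : ψ ⟨x, hs⟩ = 0 := by
      refine DFinsupp.ext fun i => ?_
      have h1 : evIdem K i • ψ ⟨x, hs⟩ = 0 := by
        rw [← map_smul, show evIdem K i • (⟨x, hs⟩ : moduleSocle (EvRing K) N) = 0 from
          Subtype.ext (hx i), map_zero]
      have h2 := congrArg (fun z => z i) h1
      rw [← h2]
      refine Finsupp.ext fun j => ?_
      exact (E_span K i _).symm
    rw [Submodule.mem_bot]
    exact congrArg Subtype.val (ψ.map_eq_zero_iff.mp h0)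
  have hsoc := socle_eq hAN
  refine Prod.ext ?_ (Prod.ext ?_ (funext fun i => ?_))
  · refine (equiv_S (K := K) (V := A K M) (fun x i => Subtype.ext (x.2 i)) _).mp ?_
    refine ⟨(LinearEquiv.ofBijective
      (LinearMap.codRestrict (A K M) (φ.symm.toLinearMap ∘ₗ LinearMap.inl (EvRing K) _ N) ?_) ⟨?_, ?_⟩).symm⟩
    · intro f i
      rw [← map_smul, hF, map_zero]
    · intro f g h
      have h : φ.symm (f, 0) = φ.symm (g, 0) := congrArg Subtype.val h
      exact congrArg Prod.fst (φ.symm.injective h)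
    · rintro ⟨m, hm⟩
      have h2 : (φ m).2 = 0 := by
        rw [← Submodule.mem_bot (EvRing K), ← hAN]
        intro i
        rw [← Prod.smul_snd, ← map_smul, hm i, map_zero]; rfl
      refine ⟨(φ m).1, Subtype.ext ?_⟩
      show φ.symm ((φ m).1, 0) = m
      rw [LinearEquiv.symm_apply_eq]
      exact Prod.ext rfl h2.symm
  · refine (equiv_S (K := K) (V := M ⧸ (A K M ⊔ U K M)) ?_ _).mp ?_
    · intro x i
      obtain ⟨m, rfl⟩ := Submodule.mkQ_surjective _ x
      rw [← map_smul, Submodule.mkQ_apply, Submodule.Quotient.mk_eq_zero]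
      exact (le_sup_right : U K M ≤ A K M ⊔ U K M) (E_le_U i (idem_smul_mem i m))
    · let g : M →ₗ[EvRing K] (N ⧸ moduleSocle (EvRing K) N) :=
        (moduleSocle (EvRing K) N).mkQ ∘ₗ LinearMap.snd (EvRing K) _ N ∘ₗ φ.toLinearMap
      have hg : Function.Surjective g :=
        (Submodule.mkQ_surjective _).comp (Prod.snd_surjective.comp φ.surjective)
      have hmem : ∀ m, m ∈ LinearMap.ker g ↔ (φ m).2 ∈ U K N := fun m => by
        rw [LinearMap.mem_ker, ← hsoc]
        exact Submodule.Quotient.mk_eq_zero _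
      have hker : A K M ⊔ U K M = LinearMap.ker g := by
        refine le_antisymm (sup_le (fun m hm => ?_) (fun m hm => ?_)) (fun m hm => ?_)
        · rw [hmem]
          have h2 : (φ m).2 = 0 := by
            rw [← Submodule.mem_bot (EvRing K), ← hAN]
            intro i
            rw [← Prod.smul_snd, ← map_smul, hm i, map_zero]; rfl
          rw [h2]; exact zero_mem _
        · rw [hmem]
          exact U_map (LinearMap.snd (EvRing K) _ N ∘ₗ φ.toLinearMap) hm
        · rw [hmem] at hm
          refine Submodule.mem_sup.mpr ⟨φ.symm ((φ m).1, 0), fun i => ?_, φ.symm (0, (φ m).2), ?_, ?_⟩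
          · rw [← map_smul, Prod.smul_mk, hF, smul_zero, ← Prod.zero_eq_mk, map_zero]
          · exact U_map (φ.symm.toLinearMap ∘ₗ LinearMap.inr (EvRing K) _ N) hm
          · rw [← map_add, LinearEquiv.symm_apply_eq]
            ext1 <;> simp
      exact ⟨Submodule.quotEquivOfEq _ _ hker ≪≫ₗ g.quotKerEquivOfSurjective hg ≪≫ₗ χ⟩
  · refine (equiv_E (K := K) (V := E K M i) i (fun x => Subtype.ext x.2) _).mp ?_
    let h : (Quotient.out (ks i) →₀ (Ideal.span {evIdem K i} : Ideal (EvRing K))) →ₗ[EvRing K] M :=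
      φ.symm.toLinearMap ∘ₗ LinearMap.inr (EvRing K) _ N ∘ₗ (moduleSocle (EvRing K) N).subtype ∘ₗ
        ψ.symm.toLinearMap ∘ₗ DirectSum.lof (EvRing K) ℕ
          (fun i => (Quotient.out (ks i) →₀ (Ideal.span {evIdem K i} : Ideal (EvRing K)))) i
    refine ⟨(LinearEquiv.ofBijective (LinearMap.codRestrict (E K M i) h ?_) ⟨?_, ?_⟩).symm⟩
    · intro x
      rw [mem_E, ← map_smul]
      congr 1
      refine Finsupp.ext fun j => ?_
      exact E_span K i _
    · intro x y hxy
      have hxy : h x = h y := congrArg Subtype.val hxy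
      have h1 := φ.symm.injective hxy
      have h2 := (ψ.symm.injective (Subtype.ext (congrArg Prod.snd h1)))
      exact DirectSum.of_injective i h2
    · rintro ⟨m, hm⟩
      have hfix : evIdem K i • φ m = φ m := by rw [← map_smul, mem_E.mp hm]
      have h1 : (φ m).1 = 0 := by
        rw [← hfix]; exact hF _ i
      have h2 : evIdem K i • (φ m).2 = (φ m).2 := congrArg Prod.snd hfix
      have hs : (φ m).2 ∈ moduleSocle (EvRing K) N := E_le_socle (K := K) i h2
      have h3 : evIdem K i • ψ ⟨_, hs⟩ = ψ ⟨_, hs⟩ := by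
        rw [← map_smul]; congr 1; exact Subtype.ext h2
      have h4 : DirectSum.lof (EvRing K) ℕ
          (fun i => (Quotient.out (ks i) →₀ (Ideal.span {evIdem K i} : Ideal (EvRing K)))) i
            (ψ ⟨_, hs⟩ i) = ψ ⟨_, hs⟩ := by
        refine DFinsupp.ext fun j => ?_
        by_cases hj : i = j
        · subst hj
          exact DirectSum.of_eq_same _ _
        · refine (DirectSum.of_eq_of_ne _ _ _ (Ne.symm hj)).trans ?_
          rw [← h3]
          refine Finsupp.ext fun t => ?_
          refine Eq.symm ?_
          refine (?_ : evIdem K i • (ψ ⟨_, hs⟩ j t) = 0)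
          exact smul_E_ne hj (E_span K j _)
      refine ⟨ψ ⟨_, hs⟩ i, Subtype.ext ?_⟩
      show φ.symm (0, (ψ.symm (DirectSum.lof (EvRing K) ℕ _ i (ψ ⟨_, hs⟩ i))).1) = m
      rw [h4, LinearEquiv.symm_apply_eq, LinearEquiv.symm_apply_apply]
      exact Prod.ext h1.symm rfl

end EvH

open DirectSum in
/-- Structure theorem for modules over the ring `R` of eventually constant sequences:
every module `M` decomposes, for uniquely determined cardinals `κ`, `λ`, `κ_i (i < ω)`,
as `M ≅ S^(κ) ⊕ N` where `Soc(N) ≅ ⊕_{i<ω} (e_i R)^(κ_i)` and `N/Soc(N) ≅ S^(λ)`.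
Here `S = R/Soc(R)` and `X^(κ)` is the direct sum of `κ` copies of `X`. -/
theorem evRing_module_decomposition (K : Type u) [Field K]
    (M : Type v) [AddCommGroup M] [Module (EvRing K) M] :
    ∃! c : Cardinal.{max u v} × Cardinal.{max u v} × (ℕ → Cardinal.{max u v}),
      ∃ (N : Type (max u v)) (_ : AddCommGroup N) (_ : Module (EvRing K) N),
        Nonempty (M ≃ₗ[EvRing K]
          ((Quotient.out c.1 →₀
              (EvRing K ⧸ (moduleSocle (EvRing K) (EvRing K) : Ideal (EvRing K)))) × N)) ∧
        Nonempty ((moduleSocle (EvRing K) N) ≃ₗ[EvRing K]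
          ⨁ i : ℕ, (Quotient.out (c.2.2 i) →₀ (Ideal.span {evIdem K i} : Ideal (EvRing K)))) ∧
        Nonempty ((N ⧸ moduleSocle (EvRing K) N) ≃ₗ[EvRing K]
          (Quotient.out c.2.1 →₀
            (EvRing K ⧸ (moduleSocle (EvRing K) (EvRing K) : Ideal (EvRing K))))) := by
  let _ : Module K M := Module.compHom M (algebraMap K (EvRing K))
  have _ : IsScalarTower K (EvRing K) M := ⟨fun a b x => by
    show (a • b) • x = (algebraMap K (EvRing K) a) • (b • x)
    rw [smul_smul, Algebra.smul_def]⟩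
  exact existsUnique_of_exists_of_unique (EvH.P_exists K M) fun c d hc hd =>
    (EvH.P_unique K M c hc).trans (EvH.P_unique K M d hd).symm
end

section
/- Let K be a field and R the subalgebra of K^ω of eventually constant sequences. Then every countably generated submodule of an R-projective R-module is projective; in particular, every countably generated R-projective R-module is projective. -/
/-- A module `M` over a commutative ring `R` is `R`-projective if for every ideal `I` of `R`,
every `R`-homomorphism `M → R/I` factors through the canonical projection `R → R/I`. -/
def IsRProjective (R : Type*) [CommRing R] (M : Type*) [AddCommGroup M] [Module R M] : Prop :=
  ∀ (I : Ideal R) (f : M →ₗ[R] R ⧸ I), ∃ g : M →ₗ[R] R, f = (Submodule.mkQ I).comp g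

namespace EvAux
open Filter

variable {K : Type*} [Field K]

theorem seq_ext {a b : EvRing K} (h : ∀ n, a.seq n = b.seq n) : a = b :=
  Subtype.ext (funext h)
theorem seq_add (a b : EvRing K) (n : ℕ) : (a + b).seq n = a.seq n + b.seq n := rfl
theorem seq_sub (a b : EvRing K) (n : ℕ) : (a - b).seq n = a.seq n - b.seq n := rfl
theorem seq_mul (a b : EvRing K) (n : ℕ) : (a * b).seq n = a.seq n * b.seq n := rfl
theorem seq_zero (n : ℕ) : (0 : EvRing K).seq n = 0 := rfl
theorem seq_one (n : ℕ) : (1 : EvRing K).seq n = 1 := rfl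
theorem seq_C (c : K) (n : ℕ) : (algebraMap K (EvRing K) c).seq n = c := rfl
theorem seq_idem (i n : ℕ) : (evIdem K i).seq n = if n = i then 1 else 0 := rfl

theorem ev (a : EvRing K) : ∃ c : K, ∀ᶠ n in atTop, a.seq n = c := by
  obtain ⟨N, c, h⟩ := Subtype.property (p := fun x => x ∈ evConst K) a
  exact ⟨c, eventually_atTop.2 ⟨N, h⟩⟩

theorem exists_mk (x : ℕ → K) (c : K) (h : ∀ᶠ n in atTop, x n = c) :
    ∃ a : EvRing K, ∀ n, a.seq n = x n := by
  obtain ⟨N, hN⟩ := eventually_atTop.1 h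
  exact ⟨(⟨x, N, c, hN⟩ : evConst K), fun _ => rfl⟩

/-- The ideal of eventually zero sequences. -/
def evS (K : Type*) [Field K] : Ideal (EvRing K) where
  carrier := {a | ∀ᶠ n in atTop, a.seq n = 0}
  add_mem' := by
    intro a b ha hb
    filter_upwards [ha, hb] with n h1 h2
    simp [seq_add, h1, h2]
  zero_mem' := Eventually.of_forall fun _ => rfl
  smul_mem' := by
    intro c a ha
    filter_upwards [ha] with n h1
    simp [seq_mul, h1]

theorem mem_evS {a : EvRing K} : a ∈ evS K ↔ ∀ᶠ n in atTop, a.seq n = 0 := Iff.rfl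

theorem idem_mem (I : Ideal (EvRing K)) {a : EvRing K} (ha : a ∈ I) {n : ℕ} (h : a.seq n ≠ 0) :
    evIdem K n ∈ I := by
  have : evIdem K n = (evIdem K n * algebraMap K (EvRing K) (a.seq n)⁻¹) * a := by
    apply seq_ext
    intro m
    simp only [seq_mul, seq_C, seq_idem]
    split_ifs with hm
    · subst hm; field_simp
    · simp
  rw [this]
  exact I.mul_mem_left _ ha

theorem mem_of_bdd (I : Ideal (EvRing K)) {a : EvRing K} (k : ℕ) (hk : ∀ n, k ≤ n → a.seq n = 0)
    (h : ∀ n, a.seq n ≠ 0 → evIdem K n ∈ I) : a ∈ I := by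
  induction k generalizing a with
  | zero =>
    have : a = 0 := seq_ext fun n => hk n (Nat.zero_le n)
    rw [this]; exact I.zero_mem
  | succ k ih =>
    have h1 : a - a * evIdem K k ∈ I := by
      apply ih
      · intro n hn
        simp only [seq_sub, seq_mul, seq_idem]
        split_ifs with hh
        · simp
        · simp [hk n (by omega)]
      · intro n hn
        apply h
        intro h0
        simp [seq_sub, seq_mul, h0] at hn
    have h2 : a * evIdem K k ∈ I := by
      by_cases h0 : a.seq k = 0
      · have : a * evIdem K k = 0 := by
          apply seq_ext
          intro n
          simp only [seq_mul, seq_idem, seq_zero]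
          split_ifs with hh
          · simp [hh, h0]
          · simp
        rw [this]; exact I.zero_mem
      · exact I.mul_mem_left _ (h k h0)
    have := I.add_mem h1 h2
    simpa using this

/-- An ideal that is either cofinite or of cobounded support is generated by an idempotent. -/
theorem exists_idem (I : Ideal (EvRing K))
    (h : (∃ a ∈ I, a ∉ evS K) ∨ ∀ᶠ n in atTop, evIdem K n ∉ I) :
    ∃ f : EvRing K, f * f = f ∧ ∀ r, r ∈ I ↔ r * f = 0 := by
  classical
  have hA : ∀ a ∈ I, a ∉ evS K → ∃ c, c ≠ 0 ∧ ∀ᶠ n in atTop, a.seq n = c := by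
    intro a _ haS
    obtain ⟨c, hc⟩ := ev a
    refine ⟨c, ?_, hc⟩
    rintro rfl
    exact haS hc
  have hT : ∃ c : K, ∀ᶠ n in atTop, (if evIdem K n ∈ I then (0 : K) else 1) = c := by
    rcases h with ⟨a, ha, haS⟩ | h
    · obtain ⟨c, hc0, hc⟩ := hA a ha haS
      refine ⟨0, ?_⟩
      filter_upwards [hc] with n hn
      rw [if_pos (idem_mem I ha (by rw [hn]; exact hc0))]
    · refine ⟨1, ?_⟩
      filter_upwards [h] with n hn
      rw [if_neg hn]
  obtain ⟨c, hc⟩ := hT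
  obtain ⟨f, hf⟩ := exists_mk _ c hc
  refine ⟨f, ?_, ?_⟩
  · apply seq_ext
    intro n
    rw [seq_mul, hf]
    split_ifs <;> simp
  · intro r
    constructor
    · intro hr
      apply seq_ext
      intro n
      rw [seq_mul, hf, seq_zero]
      split_ifs with hn
      · simp
      · by_contra h0
        exact hn (idem_mem I hr (fun h1 => h0 (by simp [h1])))
    · intro hr
      have hr' : ∀ n, r.seq n ≠ 0 → evIdem K n ∈ I := by
        intro n hn
        by_contra hI
        have : (r * f).seq n = 0 := by rw [hr]; rfl
        rw [seq_mul, hf, if_neg hI, mul_one] at this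
        exact hn this
      rcases h with ⟨a, ha, haS⟩ | h
      · obtain ⟨d, hd0, hd⟩ := hA a ha haS
        obtain ⟨k, hk⟩ := eventually_atTop.1 hd
        have h1 : r - (r * algebraMap K (EvRing K) d⁻¹) * a ∈ I := by
          apply mem_of_bdd I k
          · intro n hn
            rw [seq_sub, seq_mul, seq_mul, seq_C, hk n hn]
            field_simp
            simp
          · intro n hn
            apply hr'
            intro h0
            apply hn
            simp [seq_sub, seq_mul, h0]
        have h2 := I.add_mem h1 (I.mul_mem_left (r * algebraMap K (EvRing K) d⁻¹) ha)
        simpa using h2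
      · obtain ⟨k, hk⟩ := eventually_atTop.1 h
        apply mem_of_bdd I k _ hr'
        intro n hn
        by_contra h0
        exact hk n hn (hr' n h0)

theorem kill {M : Type*} [AddCommGroup M] [Module (EvRing K) M] (z : M)
    (hz : z ∈ evS K • (⊤ : Submodule (EvRing K) M)) :
    ∃ a : EvRing K, (∀ᶠ n in atTop, a.seq n = 1) ∧ a • z = 0 := by
  classical
  induction hz using Submodule.smul_induction_on' with
  | smul r hr m hm =>
    obtain ⟨k, hk⟩ := eventually_atTop.1 (mem_evS.1 hr)
    have h1 : ∀ᶠ n in atTop, (if k ≤ n then (1 : K) else 0) = 1 := by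
      filter_upwards [eventually_ge_atTop k] with n hn
      rw [if_pos hn]
    obtain ⟨a, ha⟩ := exists_mk _ 1 h1
    refine ⟨a, by simpa only [ha] using h1, ?_⟩
    rw [smul_smul]
    have : a * r = 0 := by
      apply seq_ext
      intro n
      rw [seq_mul, ha, seq_zero]
      split_ifs with hn
      · simp [hk n hn]
      · simp
    rw [this, zero_smul]
  | add x _ y _ hx hy =>
    obtain ⟨a, ha, hax⟩ := hx
    obtain ⟨b, hb, hby⟩ := hy
    refine ⟨a * b, ?_, ?_⟩
    · filter_upwards [ha, hb] with n h1 h2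
      simp [seq_mul, h1, h2]
    · rw [smul_add, mul_smul a b y, hby, mul_comm a b, mul_smul b a x, hax]
      simp

theorem exists_functional {M : Type*} [AddCommGroup M] [Module (EvRing K) M]
    (Q : Submodule (EvRing K) M) (hQ : evS K • (⊤ : Submodule (EvRing K) M) ≤ Q) (x : M)
    (hx : x ∉ Q) :
    ∃ f : M →ₗ[EvRing K] EvRing K ⧸ evS K, (∀ y ∈ Q, f y = 0) ∧ f x = Submodule.mkQ (evS K) 1 := by
  letI : Module K (M ⧸ Q) := Module.compHom (M ⧸ Q) (algebraMap K (EvRing K))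
  have hsm : ∀ (c : K) (m : M ⧸ Q), c • m = algebraMap K (EvRing K) c • m := fun _ _ => rfl
  have hx0 : Q.mkQ x ≠ 0 := by
    simpa using hx
  obtain ⟨φ, hφ⟩ : ∃ φ : (M ⧸ Q) →ₗ[K] K, φ (Q.mkQ x) = 1 := by
    obtain ⟨φ, hφ⟩ : ∃ φ : Module.Dual K (M ⧸ Q), φ (Q.mkQ x) ≠ 0 := by
      by_contra! hcon
      exact hx0 ((Module.forall_dual_apply_eq_zero_iff K _).1 hcon)
    exact ⟨(φ (Q.mkQ x))⁻¹ • φ, inv_mul_cancel₀ hφ⟩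
  refine ⟨{ toFun := fun m => Submodule.mkQ (evS K) (algebraMap K (EvRing K) (φ (Q.mkQ m)))
            map_add' := ?_
            map_smul' := ?_ }, ?_, ?_⟩
  · intro a b
    simp only [map_add]
  · intro r m
    obtain ⟨c, hc⟩ := ev r
    have h0 : r - algebraMap K (EvRing K) c ∈ evS K := by
      rw [mem_evS]
      filter_upwards [hc] with n hn
      simp [seq_sub, seq_C, hn]
    have h1 : Q.mkQ (r • m) = c • Q.mkQ m := by
      rw [hsm, ← map_smul, ← sub_eq_zero, ← map_sub, ← sub_smul]
      simp only [Submodule.mkQ_apply, Submodule.Quotient.mk_eq_zero]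
      exact hQ (Submodule.smul_mem_smul h0 trivial)
    rw [h1, map_smul φ, RingHom.id_apply, ← map_smul (Submodule.mkQ (evS K)), ← sub_eq_zero, ← map_sub]
    simp only [Submodule.mkQ_apply, Submodule.Quotient.mk_eq_zero]
    rw [mem_evS]
    filter_upwards [hc] with n hn
    simp [seq_sub, seq_C, smul_eq_mul, seq_mul, hn]
  · intro y hy
    have : Q.mkQ y = 0 := by simpa using hy
    change Submodule.mkQ (evS K) (algebraMap K (EvRing K) (φ (Q.mkQ y))) = 0
    rw [this]; simp
  · change Submodule.mkQ (evS K) (algebraMap K (EvRing K) (φ (Q.mkQ x))) = _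
    rw [hφ, map_one]

theorem key {M : Type*} [AddCommGroup M] [Module (EvRing K) M] (hM : IsRProjective (EvRing K) M)
    (t : Set M) (ht : t.Finite) (x : M) :
    ∃ f : EvRing K, f * f = f ∧ ∀ r : EvRing K, r • x ∈ Submodule.span (EvRing K) t ↔ r * f = 0 := by
  set F := Submodule.span (EvRing K) t with hF
  let I : Ideal (EvRing K) := F.comap (LinearMap.toSpanSingleton (EvRing K) M x)
  have hI : ∀ r, r ∈ I ↔ r • x ∈ F := fun r => Iff.rfl
  suffices h : (∃ a ∈ I, a ∉ evS K) ∨ ∀ᶠ n in atTop, evIdem K n ∉ I by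
    obtain ⟨f, h1, h2⟩ := exists_idem I h
    exact ⟨f, h1, fun r => (hI r).symm.trans (h2 r)⟩
  by_cases hx : x ∈ F ⊔ evS K • (⊤ : Submodule (EvRing K) M)
  · left
    obtain ⟨y, hy, z, hz, rfl⟩ := Submodule.mem_sup.1 hx
    obtain ⟨a, ha, haz⟩ := kill z hz
    refine ⟨a, ?_, ?_⟩
    · rw [hI, smul_add, haz, add_zero]
      exact F.smul_mem _ hy
    · intro h
      obtain ⟨n, h1, h2⟩ := (ha.and (mem_evS.1 h)).exists
      rw [h1] at h2
      exact one_ne_zero h2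
  · right
    obtain ⟨f, hf0, hf1⟩ := exists_functional _ le_sup_right x hx
    obtain ⟨g, rfl⟩ := hM _ f
    have hgx : ∀ᶠ n in atTop, (g x).seq n = 1 := by
      have : g x - 1 ∈ evS K := by
        rw [LinearMap.comp_apply, ← sub_eq_zero, ← map_sub] at hf1
        simpa only [Submodule.mkQ_apply, Submodule.Quotient.mk_eq_zero] using hf1
      filter_upwards [mem_evS.1 this] with n hn
      rw [seq_sub, seq_one] at hn
      exact sub_eq_zero.1 hn
    have hgt : ∀ᶠ n in atTop, ∀ y ∈ t, (g y).seq n = 0 := by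
      rw [eventually_all_finite ht]
      intro y hy
      have := hf0 y (le_sup_left (a := F) (Submodule.subset_span hy))
      rw [LinearMap.comp_apply] at this
      exact mem_evS.1 (by simpa only [Submodule.mkQ_apply, Submodule.Quotient.mk_eq_zero] using this)
    filter_upwards [hgx, hgt] with n h1 h2
    intro hn
    rw [hI] at hn
    have h3 : ∀ y ∈ F, (g y).seq n = 0 := by
      intro y hy
      induction hy using Submodule.span_induction with
      | mem y hy => exact h2 y hy
      | zero => rw [map_zero]; rfl
      | add a b _ _ ha hb => rw [map_add, seq_add, ha, hb, add_zero]
      | smul r a _ ha => rw [map_smul, smul_eq_mul, seq_mul, ha, mul_zero]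
    have h4 := h3 _ hn
    rw [map_smul, smul_eq_mul, seq_mul, h1, seq_idem, if_pos rfl] at h4
    simp at h4

theorem proj_of_chain {A M : Type*} [CommRing A] [AddCommGroup M] [Module A M] (x : ℕ → M)
    (h : ∀ n, ∃ f : A, f * f = f ∧ ∀ r : A, r • x n ∈ Submodule.span A (x '' Set.Iio n) ↔ r * f = 0) :
    Module.Projective A (Submodule.span A (Set.range x)) := by
  choose f hff hf using h
  let y : ℕ → M := fun n => f n • x n
  have hfy : ∀ n, f n • y n = y n := fun n => by simp only [y, smul_smul, hff]
  have hxy : ∀ n, x n ∈ Submodule.span A (y '' Set.Iio (n + 1)) := by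
    intro n
    induction n using Nat.strong_induction_on with
    | _ n ih =>
      have h1 : (1 - f n) • x n ∈ Submodule.span A (x '' Set.Iio n) := by
        rw [hf, sub_mul, hff, one_mul, sub_self]
      have h2 : Submodule.span A (x '' Set.Iio n) ≤ Submodule.span A (y '' Set.Iio (n + 1)) := by
        rw [Submodule.span_le]
        rintro _ ⟨m, hm, rfl⟩
        have hm' : m < n := hm
        refine Submodule.span_mono (Set.image_mono ?_) (ih m hm')
        intro j hj
        simp only [Set.mem_Iio] at hj ⊢
        omega
      have h3 : y n ∈ Submodule.span A (y '' Set.Iio (n + 1)) :=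
        Submodule.subset_span ⟨n, by simp, rfl⟩
      have := Submodule.add_mem _ (h2 h1) h3
      simpa [y, sub_smul] using this
  have hspan : Submodule.span A (Set.range x) = Submodule.span A (Set.range y) := by
    apply le_antisymm
    · rw [Submodule.span_le]
      rintro _ ⟨n, rfl⟩
      exact Submodule.span_mono (Set.image_subset_range _ _) (hxy n)
    · rw [Submodule.span_le]
      rintro _ ⟨n, rfl⟩
      exact Submodule.smul_mem _ _ (Submodule.subset_span ⟨n, rfl⟩)
  have hind : ∀ (m : ℕ) (r : ℕ → A), ∑ i ∈ Finset.range m, r i • y i = 0 →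
      ∀ i < m, r i * f i = 0 := by
    intro m r
    induction m with
    | zero => intro _ i hi; omega
    | succ m ih =>
      intro hs i hi
      rw [Finset.sum_range_succ] at hs
      have h1 : (r m * f m) • x m ∈ Submodule.span A (x '' Set.Iio m) := by
        have : (r m * f m) • x m = - ∑ i ∈ Finset.range m, r i • y i := by
          rw [mul_smul]
          exact eq_neg_of_add_eq_zero_right hs
        rw [this]
        refine Submodule.neg_mem _ (Submodule.sum_mem _ fun j hj => ?_)
        exact Submodule.smul_mem _ _ (Submodule.smul_mem _ _
          (Submodule.subset_span ⟨j, by simpa using hj, rfl⟩))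
      have h2 : r m * f m = 0 := by
        have := (hf m _).1 h1
        rwa [mul_assoc, hff] at this
      have h3 : r m • y m = 0 := by
        change r m • f m • x m = 0
        rw [smul_smul, h2, zero_smul]
      rw [h3, add_zero] at hs
      rcases Nat.lt_succ_iff_lt_or_eq.1 hi with hi | rfl
      · exact ih hs i hi
      · exact h2
  let Φ : (ℕ →₀ A) →ₗ[A] M := Finsupp.linearCombination A y
  let E : (ℕ →₀ A) →ₗ[A] (ℕ →₀ A) :=
    Finsupp.lsum A fun n => (Finsupp.lsingle n).comp (LinearMap.toSpanSingleton A A (f n))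
  have hE1 : ∀ n a, E (Finsupp.single n a) = Finsupp.single n (a * f n) := by
    intro n a
    simp [E]
  have hE : ∀ r n, E r n = r n * f n := by
    intro r n
    induction r using Finsupp.induction_linear with
    | zero => simp
    | add a b ha hb => simp [ha, hb, add_mul]
    | single m a =>
      rw [hE1]
      by_cases hmn : m = n
      · subst hmn; simp
      · simp [Finsupp.single_apply, hmn]
  have hΦE : ∀ r, Φ (E r) = Φ r := by
    intro r
    induction r using Finsupp.induction_linear with
    | zero => simp
    | add a b ha hb => simp only [map_add, ha, hb]
    | single m a =>
      rw [hE1]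
      simp only [Φ, Finsupp.linearCombination_single]
      rw [mul_smul, hfy]
  have hker : LinearMap.ker Φ ≤ LinearMap.ker E := by
    intro r hr
    rw [LinearMap.mem_ker] at hr ⊢
    obtain ⟨m, hm⟩ : ∃ m, r.support ⊆ Finset.range m := Finset.exists_nat_subset_range _
    have hs : ∑ i ∈ Finset.range m, r i • y i = 0 := by
      rw [← hr]
      simp only [Φ, Finsupp.linearCombination_apply]
      rw [Finsupp.sum_of_support_subset _ hm _ (by simp)]
    ext i
    rw [hE, Finsupp.zero_apply]
    by_cases hi : i < m
    · exact hind m r hs i hi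
    · have : r i = 0 := by
        by_contra h0
        exact hi (Finset.mem_range.1 (hm (Finsupp.mem_support_iff.2 h0)))
      rw [this, zero_mul]
  have hrange : LinearMap.range Φ = Submodule.span A (Set.range x) := by
    rw [hspan]; exact Finsupp.range_linearCombination A
  rw [← hrange]
  let s : LinearMap.range Φ →ₗ[A] (ℕ →₀ A) :=
    ((LinearMap.ker Φ).liftQ E hker).comp Φ.quotKerEquivRange.symm.toLinearMap
  have hs : ∀ r, s (Φ.rangeRestrict r) = E r := by
    intro r
    have : Φ.quotKerEquivRange.symm (Φ.rangeRestrict r) = (LinearMap.ker Φ).mkQ r := by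
      rw [LinearEquiv.symm_apply_eq]
      rfl
    simp only [s, LinearMap.comp_apply, LinearEquiv.coe_coe, this]
    simp
  apply Module.Projective.of_split s Φ.rangeRestrict
  ext z
  obtain ⟨z, r, rfl⟩ := z
  have := hs r
  change Φ (s (Φ.rangeRestrict r)) = Φ r
  rw [this, hΦE]

theorem main {M : Type*} [AddCommGroup M] [Module (EvRing K) M] (hM : IsRProjective (EvRing K) M)
    (s : Set M) (hs : s.Countable) : Module.Projective (EvRing K) (Submodule.span (EvRing K) s) := by
  obtain ⟨x, hx⟩ := (hs.insert 0).exists_eq_range (Set.insert_nonempty 0 s)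
  have : Submodule.span (EvRing K) s = Submodule.span (EvRing K) (Set.range x) := by
    rw [← hx, Submodule.span_insert_zero]
  rw [this]
  exact proj_of_chain x fun n => key hM _ ((Set.finite_Iio n).image x) (x n)

end EvAux

/-- Over the ring `R` of eventually constant sequences, every countably generated submodule
of an `R`-projective module is projective; in particular, every countably generated
`R`-projective module is projective. -/
theorem evRing_countably_generated_projective (K : Type u) [Field K] :
    (∀ (M : Type v) (_ : AddCommGroup M) (_ : Module (EvRing K) M),
      IsRProjective (EvRing K) M →
      ∀ N : Submodule (EvRing K) M,
        (∃ s : Set M, s.Countable ∧ Submodule.span (EvRing K) s = N) →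
        Module.Projective (EvRing K) N) ∧
    (∀ (M : Type v) (_ : AddCommGroup M) (_ : Module (EvRing K) M),
      IsRProjective (EvRing K) M →
      (∃ s : Set M, s.Countable ∧ Submodule.span (EvRing K) s = ⊤) →
      Module.Projective (EvRing K) M) := by
  refine ⟨?_, ?_⟩
  · rintro M _ _ hM N ⟨s, hs, rfl⟩
    exact EvAux.main hM s hs
  · rintro M _ _ hM ⟨s, hs, htop⟩
    have h := EvAux.main hM s hs
    rw [htop] at h
    exact Module.Projective.of_equiv (Submodule.topEquiv (R := EvRing K) (M := M))
end
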